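/- Let 0 < γ < 1 and let k be a positive integer. Then for every ε > 4γ, the covering number of A_γ^k by Euclidean balls of radius ε satisfies N(A_γ^k, ε B₂^k) ≤ e^{(6γk/ε)(log(ε/(2γ)) + log(4/ε))}. -/

import Mathlib

open Finset

/-- `A_γ^k`: unit vectors `a` of `ℝ^k` with `k^{-1/2} ∑_i |a_i| ≤ γ`. -/
def Agk (k : ℕ) (γ : ℝ) : Set (Fin k → ℝ) :=
  {a | (∑ i, a i ^ 2) = 1 ∧ (Real.sqrt k)⁻¹ * ∑ i, |a i| ≤ γ}

lemma aux_round (a δ : ℝ) (hδ : 0 < δ) :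
    ∃ z : ℤ, (z.natAbs : ℝ) * δ ≤ |a| ∧ (a - z * δ) ^ 2 ≤ δ * |a| := by
  have key : ∀ b : ℝ, 0 ≤ b →
      ∃ z : ℤ, (z.natAbs : ℝ) * δ ≤ b ∧ (b - z * δ) ^ 2 ≤ δ * b := by
    intro b hb
    refine ⟨((⌊b / δ⌋₊ : ℕ) : ℤ), ?_⟩
    have h1 : (⌊b / δ⌋₊ : ℝ) * δ ≤ b := by
      rw [← le_div_iff₀ hδ]; exact Nat.floor_le (by positivity)
    have h2 : b < ((⌊b / δ⌋₊ : ℝ) + 1) * δ := by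
      rw [← div_lt_iff₀ hδ]; exact Nat.lt_floor_add_one _
    have h3 : 0 ≤ (⌊b / δ⌋₊ : ℝ) * δ := by positivity
    refine ⟨by simpa using h1, ?_⟩
    push_cast
    rw [sq]
    apply mul_le_mul <;> linarith
  rcases le_total 0 a with h | h
  · rw [abs_of_nonneg h]; exact key a h
  · rw [abs_of_nonpos h]
    obtain ⟨z, h1, h2⟩ := key (-a) (by linarith)
    refine ⟨-z, by simpa using h1, ?_⟩
    push_cast
    convert h2 using 1
    ring

lemma aux_sum (l : ℝ) (N : ℕ) :
    (∑ z ∈ Finset.Icc (-(N:ℤ)) N, l ^ z.natAbs) * (1 - l) = 1 + l - 2 * l ^ (N + 1) := by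
  induction N with
  | zero => simp; ring
  | succ n ih =>
    have : Finset.Icc (-((n+1 : ℕ):ℤ)) ((n+1 : ℕ):ℤ)
        = insert ((n:ℤ)+1) (insert (-((n:ℤ)+1)) (Finset.Icc (-(n:ℤ)) n)) := by
      ext x; simp only [Finset.mem_Icc, Finset.mem_insert]; push_cast; omega
    rw [this, Finset.sum_insert, Finset.sum_insert, add_mul, add_mul, ih]
    · have e1 : ((n:ℤ)+1).natAbs = n + 1 := by omega
      have e2 : (-((n:ℤ)+1)).natAbs = n + 1 := by omega
      rw [e1, e2]; ring
    · simp only [Finset.mem_Icc]; omega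
    · simp only [Finset.mem_Icc, Finset.mem_insert]; omega

lemma aux_sum_le (l : ℝ) (h0 : 0 < l) (h1 : l ≤ 1 / 2) (N : ℕ) :
    (∑ z ∈ Finset.Icc (-(N:ℤ)) N, l ^ z.natAbs) ≤ Real.exp (4 * l) := by
  have h := aux_sum l N
  have hp : 0 < l ^ (N + 1) := by positivity
  have : (∑ z ∈ Finset.Icc (-(N:ℤ)) N, l ^ z.natAbs) ≤ 4 * l + 1 := by
    by_contra! hc
    have := mul_lt_mul_of_pos_right hc (show 0 < 1 - l by linarith)
    nlinarith
  exact this.trans (Real.add_one_le_exp _)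

lemma aux_count (k N : ℕ) (l : ℝ) (h0 : 0 < l) (h1 : l ≤ 1 / 2) :
    ((((Fintype.piFinset fun _ : Fin k => Finset.Icc (-(N:ℤ)) N).filter
      (fun z => ∑ i, (z i).natAbs ≤ N)).card : ℕ) : ℝ) * l ^ N ≤ Real.exp (4 * l * k) := by
  calc _ = ∑ z ∈ ((Fintype.piFinset fun _ : Fin k => Finset.Icc (-(N:ℤ)) N).filter
      (fun z => ∑ i, (z i).natAbs ≤ N)), l ^ N := by simp
    _ ≤ ∑ z ∈ ((Fintype.piFinset fun _ : Fin k => Finset.Icc (-(N:ℤ)) N).filter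
      (fun z => ∑ i, (z i).natAbs ≤ N)), ∏ i, l ^ (z i).natAbs := by
        apply Finset.sum_le_sum
        intro z hz
        rw [Finset.prod_pow_eq_pow_sum]
        exact pow_le_pow_of_le_one h0.le (by linarith) (Finset.mem_filter.1 hz).2
    _ ≤ ∑ z ∈ (Fintype.piFinset fun _ : Fin k => Finset.Icc (-(N:ℤ)) N),
          ∏ i, l ^ (z i).natAbs := by
        apply Finset.sum_le_sum_of_subset_of_nonneg (Finset.filter_subset _ _)
        intros; positivity
    _ = ∏ _i : Fin k, ∑ z ∈ Finset.Icc (-(N:ℤ)) N, l ^ z.natAbs := by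
        rw [Finset.prod_univ_sum]
    _ ≤ ∏ _i : Fin k, Real.exp (4 * l) := by
        apply Finset.prod_le_prod
        · intros; positivity
        · intros; exact aux_sum_le l h0 h1 N
    _ = _ := by
        rw [Finset.prod_const, ← Real.exp_nat_mul]; simp; ring

theorem stmt16 (γ : ℝ) (hγ0 : 0 < γ) (hγ1 : γ < 1) (k : ℕ) (hk : 0 < k)
    (ε : ℝ) (hε : 4 * γ < ε) :
    ∃ T : Finset (Fin k → ℝ),
      (T.card : ℝ) ≤
        Real.exp (6 * γ * k / ε * (Real.log (ε / (2 * γ)) + Real.log (4 / ε))) ∧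
      Agk k γ ⊆ ⋃ t ∈ T, {x | Real.sqrt (∑ i, (x i - t i) ^ 2) ≤ ε} := by
  have hε0 : 0 < ε := by linarith
  have hk' : (0:ℝ) < k := by exact_mod_cast hk
  have hlog : Real.log (ε / (2 * γ)) + Real.log (4 / ε) = Real.log (2 / γ) := by
    rw [← Real.log_mul (by positivity) (by positivity)]
    congr 1; field_simp; norm_num
  rw [hlog]
  have hL0 : 0 ≤ Real.log (2 / γ) := Real.log_nonneg (by rw [le_div_iff₀ hγ0]; linarith)
  rcases le_or_gt 1 ε with h1 | h1
  · refine ⟨{0}, ?_, ?_⟩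
    · simp only [Finset.card_singleton, Nat.cast_one]
      apply Real.one_le_exp; positivity
    · rintro a ⟨ha, -⟩
      simp [ha, h1]
  · classical
    have hs : 0 < Real.sqrt k := Real.sqrt_pos.2 hk'
    have hss : Real.sqrt k * Real.sqrt k = k := Real.mul_self_sqrt hk'.le
    set δ := ε ^ 2 / (γ * Real.sqrt k) with hδ
    have hδ0 : 0 < δ := by positivity
    set M := γ ^ 2 * k / ε ^ 2 with hM
    have hM0 : 0 ≤ M := by positivity
    set N := ⌊M⌋₊ with hN
    refine ⟨((Fintype.piFinset fun _ : Fin k => Finset.Icc (-(N:ℤ)) N).filter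
      (fun z => ∑ i, (z i).natAbs ≤ N)).image (fun z i => (z i : ℝ) * δ), ?_, ?_⟩
    · refine (Nat.cast_le.2 Finset.card_image_le).trans ?_
      have hc := aux_count k N (γ / 2) (by positivity) (by linarith)
      have hl : (γ / 2) ^ N = Real.exp (-(N * Real.log (2 / γ))) := by
        rw [← mul_neg, ← Real.log_inv, inv_div, Real.exp_nat_mul, Real.exp_log (by positivity)]
      rw [hl, Real.exp_neg, ← div_eq_mul_inv, div_le_iff₀ (Real.exp_pos _), ← Real.exp_add] at hc
      refine hc.trans (Real.exp_le_exp.2 ?_)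
      have hL1 : 1 ≤ Real.log (2 / γ) := by
        rw [Real.le_log_iff_exp_le (by positivity)]
        have := Real.exp_one_lt_d9
        rw [le_div_iff₀ hγ0]
        nlinarith
      have hNM : (N:ℝ) ≤ M := Nat.floor_le hM0
      have hq : M ≤ γ * k / ε := by
        rw [hM, div_le_div_iff₀ (by positivity) hε0]
        have : 0 ≤ γ * k * ε * (ε - γ) :=
          mul_nonneg (by positivity) (by linarith)
        nlinarith
      have hq2 : γ * k ≤ γ * k / ε := by
        rw [le_div_iff₀ hε0]
        exact mul_le_of_le_one_right (by positivity) h1.le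
      have e : 6 * γ * k / ε = 6 * (γ * k / ε) := by ring
      rw [e]
      have hQ : 0 ≤ γ * k / ε := by positivity
      nlinarith [mul_le_mul_of_nonneg_right (hNM.trans hq) hL0, mul_le_mul_of_nonneg_left hL1 hQ]
    · rintro a ⟨ha, hb⟩
      have hb' : ∑ i, |a i| ≤ γ * Real.sqrt k := by
        rw [inv_mul_le_iff₀ hs] at hb; linarith
      choose z hz1 hz2 using fun i => aux_round (a i) δ hδ0
      have hsum : ∑ i, (z i).natAbs ≤ N := by
        apply Nat.le_floor
        push_cast
        have : (∑ i, ((z i).natAbs : ℝ)) * δ ≤ γ * Real.sqrt k := by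
          rw [Finset.sum_mul]
          exact (Finset.sum_le_sum fun i _ => hz1 i).trans hb'
        rw [← le_div_iff₀ hδ0] at this
        have e : γ * Real.sqrt k / δ = M := by
          rw [hδ, hM]; field_simp
          rw [sq, hss]
        rw [e] at this
        simpa using this
      have hmem : ∀ i, (z i).natAbs ≤ N := fun i =>
        (Finset.single_le_sum (f := fun i => (z i).natAbs)
          (fun _ _ => Nat.zero_le _) (Finset.mem_univ i)).trans hsum
      simp only [Set.mem_iUnion]
      refine ⟨fun i => (z i : ℝ) * δ, ?_, ?_⟩
      · refine Finset.mem_image.2 ⟨z, ?_, rfl⟩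
        rw [Finset.mem_filter, Fintype.mem_piFinset]
        refine ⟨fun i => ?_, hsum⟩
        have := hmem i
        rw [Finset.mem_Icc]; omega
      · show Real.sqrt _ ≤ ε
        apply Real.sqrt_le_iff.2 ⟨hε0.le, ?_⟩
        calc _ ≤ ∑ i, δ * |a i| := Finset.sum_le_sum fun i _ => hz2 i
          _ = δ * ∑ i, |a i| := by rw [Finset.mul_sum]
          _ ≤ δ * (γ * Real.sqrt k) := by gcongr
          _ = ε ^ 2 := by rw [hδ]; field_simp
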